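/- (Decomposition of the LAMHD-α subgrid stress divergence.) Let u_s, B_s : ℝ³ → ℝ³ be smooth vector fields with div u_s = 0 and div B_s = 0 everywhere. Define τ = ( ∇u_s·∇u_s + ∇u_s·(∇u_s)ᵀ − (∇u_s)ᵀ·∇u_s ) − ( ∇B_s·∇B_s + ∇B_s·(∇B_s)ᵀ − (∇B_s)ᵀ·∇B_s ), the symmetric and antisymmetric parts S = ½(∇u_s + (∇u_s)ᵀ), Ω = ½(∇u_s − (∇u_s)ᵀ), Σ = ½(∇B_s + (∇B_s)ᵀ), J = ½(∇B_s − (∇B_s)ᵀ), and the scalar field Π = ½ tr(∇u_s·∇u_s) − ½ tr(∇B_s·∇B_s). Then at every point of ℝ³, div τ = 4 div( Ω·S − J·Σ ) + ∇Π. -/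

import Mathlib

open Matrix MeasureTheory

noncomputable section

abbrev V3 := Fin 3 → ℝ

/-- Partial derivative `∂_j f` of a scalar field on ℝ³. -/
def pd (j : Fin 3) (f : V3 → ℝ) (x : V3) : ℝ := fderiv ℝ f x (Pi.single j 1)

/-- Jacobian matrix field: `(∇f)_{ij} = ∂f_i/∂x_j`. -/
def grad (f : V3 → V3) (x : V3) : Matrix (Fin 3) (Fin 3) ℝ :=
  Matrix.of fun i j => pd j (fun y => f y i) x

/-- Divergence of a vector field. -/
def divV (f : V3 → V3) (x : V3) : ℝ := ∑ j, pd j (fun y => f y j) x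

/-- Divergence of a matrix field: `(div M)_i = Σ_j ∂_j M_{ij}`. -/
def divM (M : V3 → Matrix (Fin 3) (Fin 3) ℝ) (x : V3) (i : Fin 3) : ℝ :=
  ∑ j, pd j (fun y => M y i j) x

/-- Scalar Laplacian. -/
def lapS (φ : V3 → ℝ) (x : V3) : ℝ := ∑ j, pd j (fun y => pd j φ y) x

/-- Componentwise Laplacian of a vector field. -/
def lap (f : V3 → V3) (x : V3) (i : Fin 3) : ℝ := lapS (fun y => f y i) x

/-- Helmholtz operator `(1 - α²Δ)` on vector fields. -/
def helm (α : ℝ) (f : V3 → V3) (x : V3) (i : Fin 3) : ℝ := f x i - α ^ 2 * lap f x i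

/-- Helmholtz operator `(1 - α²Δ)` on scalar fields. -/
def helmS (α : ℝ) (φ : V3 → ℝ) (x : V3) : ℝ := φ x - α ^ 2 * lapS φ x

/-- Advection `(g·∇)f = Σ_j g_j ∂_j f`. -/
def advect (g f : V3 → V3) (x : V3) (i : Fin 3) : ℝ :=
  ∑ j, g x j * pd j (fun y => f y i) x

/-- `(∇f)ᵀ·g`, pointwise matrix-vector product. -/
def gradTvec (f g : V3 → V3) (x : V3) (i : Fin 3) : ℝ :=
  ∑ j, (grad f x)ᵀ i j * g x j

/-- Gradient of a scalar field. -/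
def gradS (φ : V3 → ℝ) (x : V3) (i : Fin 3) : ℝ := pd i φ x

/-- Pointwise squared Euclidean norm `|f|²`. -/
def normSq (f : V3 → V3) (x : V3) : ℝ := ∑ i, (f x i) ^ 2

/-- Squared Frobenius norm of the Jacobian, `|∇f|²`. -/
def gradNormSq (f : V3 → V3) (x : V3) : ℝ := ∑ i, ∑ j, (grad f x i j) ^ 2

theorem pd_add (j : Fin 3) {f g : V3 → ℝ} {x : V3} (hf : DifferentiableAt ℝ f x)
    (hg : DifferentiableAt ℝ g x) : pd j (fun y => f y + g y) x = pd j f x + pd j g x := by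
  simp [pd, fderiv_fun_add hf hg]

theorem pd_sub (j : Fin 3) {f g : V3 → ℝ} {x : V3} (hf : DifferentiableAt ℝ f x)
    (hg : DifferentiableAt ℝ g x) : pd j (fun y => f y - g y) x = pd j f x - pd j g x := by
  simp [pd, fderiv_fun_sub hf hg]

theorem pd_mul (j : Fin 3) {f g : V3 → ℝ} {x : V3} (hf : DifferentiableAt ℝ f x)
    (hg : DifferentiableAt ℝ g x) :
    pd j (fun y => f y * g y) x = f x * pd j g x + g x * pd j f x := by
  simp [pd, fderiv_fun_mul hf hg]

theorem pd_const_mul (j : Fin 3) (c : ℝ) {f : V3 → ℝ} {x : V3} (hf : DifferentiableAt ℝ f x) :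
    pd j (fun y => c * f y) x = c * pd j f x := by
  simp [pd, fderiv_const_mul hf]

theorem pd_sum (j : Fin 3) {f : Fin 3 → V3 → ℝ} {x : V3}
    (hf : ∀ k, DifferentiableAt ℝ (f k) x) :
    pd j (fun y => ∑ k, f k y) x = ∑ k, pd j (f k) x := by
  simp [pd, fderiv_fun_sum fun k _ => hf k]

theorem pd_comm {f : V3 → ℝ} (hf : ContDiff ℝ 2 f) (j k : Fin 3) (x : V3) :
    pd j (pd k f) x = pd k (pd j f) x := by
  have hd : DifferentiableAt ℝ (fderiv ℝ f) x :=
    (hf.fderiv_right (m := 1) (by norm_num)).differentiable (by norm_num) x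
  have hpd : ∀ a b : Fin 3, pd a (pd b f) x =
      fderiv ℝ (fderiv ℝ f) x (Pi.single a 1) (Pi.single b 1) := fun a b => by
    change fderiv ℝ (fun y => fderiv ℝ f y (Pi.single b 1)) x (Pi.single a 1) = _
    rw [fderiv_clm_apply hd (differentiableAt_const _)]
    simp
  rw [hpd, hpd]
  exact (hf.contDiffAt.isSymmSndFDerivAt (by simp)) _ _

theorem differentiable_pd {f : V3 → ℝ} (hf : ContDiff ℝ 2 f) (j : Fin 3) :
    Differentiable ℝ (pd j f) :=
  ((hf.fderiv_right (m := 1) (by norm_num)).clm_apply contDiff_const).differentiable (by norm_num)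

theorem differentiable_grad {u : V3 → V3} (hu : ContDiff ℝ 2 u) (i j : Fin 3) :
    Differentiable ℝ fun y => grad u y i j :=
  differentiable_pd (contDiff_pi.mp hu i) j

theorem differentiable_grad_mul_grad {u : V3 → V3} (hu : ContDiff ℝ 2 u) (i j : Fin 3) :
    Differentiable ℝ fun y => (grad u y * grad u y) i j := by
  simp only [Matrix.mul_apply]
  exact Differentiable.fun_sum fun k _ =>
    (differentiable_grad hu i k).mul (differentiable_grad hu k j)

theorem pd_grad_mul_grad {u : V3 → V3} (hu : ContDiff ℝ 2 u) (i j k : Fin 3) (x : V3) :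
    pd k (fun y => (grad u y * grad u y) i j) x =
      ∑ l, (grad u x i l * pd k (fun y => grad u y l j) x +
        grad u x l j * pd k (fun y => grad u y i l) x) := by
  simp only [Matrix.mul_apply]
  rw [pd_sum k fun l => ((differentiable_grad hu i l).fun_mul (differentiable_grad hu l j)) x]
  exact Finset.sum_congr rfl fun l _ =>
    pd_mul k (differentiable_grad hu i l x) (differentiable_grad hu l j x)

theorem pd_grad_comm {u : V3 → V3} (hu : ContDiff ℝ 2 u) (i j k : Fin 3) (x : V3) :
    pd k (fun y => grad u y i j) x = pd j (fun y => grad u y i k) x :=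
  pd_comm (contDiff_pi.mp hu i) k j x

/-- The gradient of a divergence-free field has divergence-free transpose. -/
theorem sum_pd_grad_eq_zero {u : V3 → V3} (hu : ContDiff ℝ 2 u) (hdiv : ∀ x, divV u x = 0)
    (k : Fin 3) (x : V3) : ∑ j, pd j (fun y => grad u y j k) x = 0 := by
  have h : pd k (fun y => ∑ j, grad u y j j) x = 0 := by
    have h0 : (fun y => ∑ j, grad u y j j) = fun _ => (0 : ℝ) := funext hdiv
    simp [h0, pd]
  rw [pd_sum k fun j => differentiable_grad hu j j x] at h
  rw [← h]
  exact Finset.sum_congr rfl fun j _ => pd_grad_comm hu j k j x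

/-- For divergence-free `u`, `div ((∇u·∇u)ᵀ) = ½ ∇ tr (∇u·∇u)`. -/
theorem divM_transpose_grad_mul_grad {u : V3 → V3} (hu : ContDiff ℝ 2 u)
    (hdiv : ∀ x, divV u x = 0) (x : V3) (i : Fin 3) :
    divM (fun y => (grad u y * grad u y)ᵀ) x i =
      1 / 2 * pd i (fun y => Matrix.trace (grad u y * grad u y)) x := by
  have hz := sum_pd_grad_eq_zero hu hdiv
  simp only [divM, Matrix.transpose_apply, Matrix.trace, Matrix.diag_apply]
  rw [pd_sum i fun j => differentiable_grad_mul_grad hu j j x]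
  simp only [pd_grad_mul_grad hu, Finset.sum_add_distrib]
  have h1 : ∑ j, ∑ l, grad u x l i * pd j (fun y => grad u y j l) x = 0 := by
    rw [Finset.sum_comm]
    simp only [← Finset.mul_sum, hz, mul_zero, Finset.sum_const_zero]
  have h2 : ∑ j, ∑ l, grad u x j l * pd j (fun y => grad u y l i) x =
      ∑ j, ∑ l, grad u x j l * pd i (fun y => grad u y l j) x := by
    simp only [pd_grad_comm hu _ i]
  have h3 : ∑ j, ∑ l, grad u x l j * pd i (fun y => grad u y j l) x =
      ∑ j, ∑ l, grad u x j l * pd i (fun y => grad u y l j) x := Finset.sum_comm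
  rw [h1, h2, h3]
  ring

/-- decomposition of the LAMHD-α subgrid stress divergence,
`div τ = 4 div(Ω·S − J·Σ) + ∇Π`. -/
theorem lamhd_stress_decomposition (us Bs : V3 → V3)
    (hus : ContDiff ℝ (⊤ : ℕ∞) us) (hBs : ContDiff ℝ (⊤ : ℕ∞) Bs)
    (hdivu : ∀ x : V3, divV us x = 0) (hdivB : ∀ x : V3, divV Bs x = 0) :
    ∀ x : V3, ∀ i : Fin 3,
      divM (fun y =>
          (grad us y * grad us y + grad us y * (grad us y)ᵀ - (grad us y)ᵀ * grad us y)
          - (grad Bs y * grad Bs y + grad Bs y * (grad Bs y)ᵀ - (grad Bs y)ᵀ * grad Bs y)) x i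
        = 4 * divM (fun y =>
              ((1 / 2 : ℝ) • (grad us y - (grad us y)ᵀ)) * ((1 / 2 : ℝ) • (grad us y + (grad us y)ᵀ))
              - ((1 / 2 : ℝ) • (grad Bs y - (grad Bs y)ᵀ)) * ((1 / 2 : ℝ) • (grad Bs y + (grad Bs y)ᵀ))) x i
          + gradS (fun y => (1 / 2) * Matrix.trace (grad us y * grad us y)
              - (1 / 2) * Matrix.trace (grad Bs y * grad Bs y)) x i := by
  intro x i
  have hu : ContDiff ℝ 2 us := contDiff_infty.mp hus 2
  have hB : ContDiff ℝ 2 Bs := contDiff_infty.mp hBs 2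
  set M : V3 → Matrix (Fin 3) (Fin 3) ℝ := fun y =>
    ((1 / 2 : ℝ) • (grad us y - (grad us y)ᵀ)) * ((1 / 2 : ℝ) • (grad us y + (grad us y)ᵀ))
      - ((1 / 2 : ℝ) • (grad Bs y - (grad Bs y)ᵀ)) * ((1 / 2 : ℝ) • (grad Bs y + (grad Bs y)ᵀ))
    with hM
  have hMd : ∀ j, DifferentiableAt ℝ (fun y => M y i j) x := fun j => by
    have hgu := fun a b => differentiable_grad hu a b x
    have hgB := fun a b => differentiable_grad hB a b x
    simp only [hM, Matrix.sub_apply, Matrix.mul_apply, Matrix.smul_apply, Matrix.add_apply,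
      Matrix.transpose_apply]
    fun_prop
  have hτ : ∀ y,
      (grad us y * grad us y + grad us y * (grad us y)ᵀ - (grad us y)ᵀ * grad us y)
        - (grad Bs y * grad Bs y + grad Bs y * (grad Bs y)ᵀ - (grad Bs y)ᵀ * grad Bs y)
      = (4 : ℝ) • M y + ((grad us y * grad us y)ᵀ - (grad Bs y * grad Bs y)ᵀ) := fun y => by
    simp only [hM, Matrix.transpose_mul, smul_sub, smul_mul_smul_comm, smul_smul, sub_mul, mul_add]
    norm_num
    abel
  have hPu := fun a b => differentiable_grad_mul_grad hu a b x
  have hPB := fun a b => differentiable_grad_mul_grad hB a b x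
  have htu : DifferentiableAt ℝ (fun y => Matrix.trace (grad us y * grad us y)) x :=
    DifferentiableAt.fun_sum fun j _ => hPu j j
  have htB : DifferentiableAt ℝ (fun y => Matrix.trace (grad Bs y * grad Bs y)) x :=
    DifferentiableAt.fun_sum fun j _ => hPB j j
  have hentry : ∀ j, pd j (fun y => ((4 : ℝ) • M y +
        ((grad us y * grad us y)ᵀ - (grad Bs y * grad Bs y)ᵀ)) i j) x =
      4 * pd j (fun y => M y i j) x + (pd j (fun y => (grad us y * grad us y)ᵀ i j) x
        - pd j (fun y => (grad Bs y * grad Bs y)ᵀ i j) x) := fun j => by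
    simp only [Matrix.add_apply, Matrix.sub_apply, Matrix.smul_apply, Matrix.transpose_apply,
      smul_eq_mul]
    rw [pd_add j ((hMd j).const_mul 4) ((hPu j i).fun_sub (hPB j i)), pd_const_mul j 4 (hMd j),
      pd_sub j (hPu j i) (hPB j i)]
  rw [gradS, pd_sub i (htu.const_mul _) (htB.const_mul _), pd_const_mul i _ htu,
    pd_const_mul i _ htB, ← divM_transpose_grad_mul_grad hu hdivu,
    ← divM_transpose_grad_mul_grad hB hdivB]
  simp only [hτ]
  simp only [divM, hentry, Finset.sum_add_distrib, Finset.sum_sub_distrib, Finset.mul_sum]
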